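/- Inequality weakening (w≠̇) is hp-admissible in S(O): if the sequent Γ ⊢ Δ has a proof of height h in S(O) and x, y are labels occurring in Γ ⊢ Δ, then Γ, x ≠̇ y ⊢ Δ has a proof of height at most h in S(O). -/

import Mathlib

set_option maxHeartbeats 1000000

namespace RIQ

/-- Roles: role names and inverse roles. -/
inductive Role : Type
  | name : ℕ → Role
  | inv  : ℕ → Role
deriving DecidableEq

/-- The inverse of a role. -/
def Role.invert : Role → Role
  | .name r => .inv r
  | .inv r  => .name r

/-- RIQ concepts in negation normal form. -/
inductive Concept : Type
  | atom : ℕ → Concept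
  | nneg : ℕ → Concept
  | inter : Concept → Concept → Concept
  | union : Concept → Concept → Concept
  | ex : Role → Concept → Concept
  | all : Role → Concept → Concept
  | atMost : ℕ → Role → Concept → Concept
  | atLeast : ℕ → Role → Concept → Concept
deriving DecidableEq

/-- ⊤ := A₀ ⊔ ¬A₀ for the fixed concept name A₀ = 0. -/
def topC : Concept := .union (.atom 0) (.nneg 0)

/-- ⊥ := A₀ ⊓ ¬A₀ for the fixed concept name A₀ = 0. -/
def botC : Concept := .inter (.atom 0) (.nneg 0)

/-- NNF-negation. -/
def nnfNeg : Concept → Concept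
  | .atom A => .nneg A
  | .nneg A => .atom A
  | .inter C D => .union (nnfNeg C) (nnfNeg D)
  | .union C D => .inter (nnfNeg C) (nnfNeg D)
  | .ex r C => .all r (nnfNeg C)
  | .all r C => .ex r (nnfNeg C)
  | .atMost n r C => .atLeast (n+1) r C
  | .atLeast 0 _ _ => botC
  | .atLeast (n+1) r C => .atMost n r C

/-- Literals: concept names and their negations. -/
def IsLiteral : Concept → Prop
  | .atom _ => True
  | .nneg _ => True
  | _ => False

/-- A complex role inclusion axiom r₁ ∘ ⋯ ∘ rₙ ⊑ s. -/
structure RIA where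
  lhs : List Role
  rhs : Role
deriving DecidableEq

/-- An ontology: a finite set of RIAs (RBox) together with a finite set of
GCIs (TBox), each GCI ⊤ ⊑ C being recorded by its right-hand concept C. -/
structure Ontology where
  rias : Finset RIA
  gcis : Finset Concept

/-- Union of two ontologies. -/
def Ontology.union (O₁ O₂ : Ontology) : Ontology := ⟨O₁.rias ∪ O₂.rias, O₁.gcis ∪ O₂.gcis⟩

/-- Concept names occurring in a concept. -/
def cnames : Concept → Finset ℕ
  | .atom A => {A}
  | .nneg A => {A}
  | .inter C D => cnames C ∪ cnames D
  | .union C D => cnames C ∪ cnames D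
  | .ex _ C => cnames C
  | .all _ C => cnames C
  | .atMost _ _ C => cnames C
  | .atLeast _ _ C => cnames C

/-- Concept names occurring in an ontology. -/
def Ontology.cnames (O : Ontology) : Finset ℕ := O.gcis.sup RIQ.cnames

/-- An interpretation over the domain δ. -/
structure Interp (δ : Type) where
  cI : ℕ → Set δ
  rI : ℕ → Set (δ × δ)

/-- Interpretation of roles. -/
def Interp.roleI {δ : Type} (I : Interp δ) : Role → Set (δ × δ)
  | .name r => I.rI r
  | .inv r  => {p | (p.2, p.1) ∈ I.rI r}

/-- Relational composition of a list of roles (empty composition is the identity). -/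
def Interp.listComp {δ : Type} (I : Interp δ) : List Role → Set (δ × δ)
  | [] => {p | p.1 = p.2}
  | r :: rs => {p | ∃ b, (p.1, b) ∈ I.roleI r ∧ (b, p.2) ∈ I.listComp rs}

/-- Interpretation of concepts. -/
def Interp.cInterp {δ : Type} (I : Interp δ) : Concept → Set δ
  | .atom A => I.cI A
  | .nneg A => (I.cI A)ᶜ
  | .inter C D => I.cInterp C ∩ I.cInterp D
  | .union C D => I.cInterp C ∪ I.cInterp D
  | .ex r C => {a | ∃ b, (a, b) ∈ I.roleI r ∧ b ∈ I.cInterp C}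
  | .all r C => {a | ∀ b, (a, b) ∈ I.roleI r → b ∈ I.cInterp C}
  | .atMost n r C => {a | {b | (a, b) ∈ I.roleI r ∧ b ∈ I.cInterp C}.encard ≤ (n : ℕ∞)}
  | .atLeast n r C => {a | (n : ℕ∞) ≤ {b | (a, b) ∈ I.roleI r ∧ b ∈ I.cInterp C}.encard}

/-- I ⊨ O. -/
def Interp.models {δ : Type} (I : Interp δ) (O : Ontology) : Prop :=
  (∀ C ∈ O.gcis, I.cInterp topC ⊆ I.cInterp C) ∧
  (∀ ria ∈ O.rias, I.listComp ria.lhs ⊆ I.roleI ria.rhs)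

/-- O ⊨ C ⊑ D. -/
def entails (O : Ontology) (C D : Concept) : Prop :=
  ∀ (δ : Type) [Nonempty δ] (I : Interp δ), I.models O → I.cInterp C ⊆ I.cInterp D

/-- Production rules of the R-system G(O). -/
def ProdRule (O : Ontology) (s : Role) (T : List Role) : Prop :=
  ∃ ria ∈ O.rias, (s = ria.rhs ∧ T = ria.lhs) ∨
    (s = ria.rhs.invert ∧ T = (ria.lhs.map Role.invert).reverse)

/-- One-step derivation in the R-system G(O). -/
def OneStep (O : Ontology) (S R : List Role) : Prop :=
  ∃ S' s T R', ProdRule O s T ∧ S = S' ++ s :: R' ∧ R = S' ++ T ++ R'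

/-- The language L_{G(O)}(r). -/
def lang (O : Ontology) (r : Role) : Set (List Role) :=
  {S | Relation.ReflTransGen (OneStep O) [r] S}

/-- Structural atoms: role atoms, equality atoms and inequality atoms
(labels are natural numbers). -/
inductive SAtom : Type
  | rel : Role → ℕ → ℕ → SAtom
  | eq : ℕ → ℕ → SAtom
  | neq : ℕ → ℕ → SAtom
deriving DecidableEq

/-- Labels occurring in a structural atom. -/
def SAtom.labels : SAtom → Finset ℕ
  | .rel _ x y => {x, y}
  | .eq x y => {x, y}
  | .neq x y => {x, y}

/-- Labeled concepts. -/
abbrev LC := ℕ × Concept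

/-- Labels occurring in a finite set of structural atoms. -/
def labSetF (Γ : Finset SAtom) : Finset ℕ := Γ.biUnion SAtom.labels

/-- Labels occurring in a multiset of labeled concepts. -/
def Δlabels (Δ : Multiset LC) : Finset ℕ := (Δ.map Prod.fst).toFinset

/-- One step of the equality chain x ≈ y (an equality atom in either orientation). -/
def eqStep (Γ : Set SAtom) (x y : ℕ) : Prop := SAtom.eq x y ∈ Γ ∨ SAtom.eq y x ∈ Γ

/-- x ∼_Γ y : x and y are linked by a finite chain of equality atoms of Γ. -/
def eqRel (Γ : Set SAtom) : ℕ → ℕ → Prop := Relation.ReflTransGen (eqStep Γ)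

/-- Edge of the propagation graph PG(Γ) between the classes of x and y, labeled r. -/
def pgEdge (Γ : Set SAtom) (x : ℕ) (r : Role) (y : ℕ) : Prop :=
  (∃ z w, eqRel Γ x z ∧ eqRel Γ y w ∧ SAtom.rel r z w ∈ Γ) ∨
  (∃ z w, eqRel Γ y z ∧ eqRel Γ x w ∧ SAtom.rel r.invert z w ∈ Γ)

/-- Propagation paths: PG(Γ) ⊨ [x]_Γ ⟶^S [y]_Γ for a string S of roles. -/
def pgPath (Γ : Set SAtom) : List Role → ℕ → ℕ → Prop
  | [], x, y => eqRel Γ x y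
  | r :: S, x, y => ∃ z, pgEdge Γ x r z ∧ pgPath Γ S z y

/-- PG(Γ) ⊨ [x]_Γ ⟶^L [y]_Γ with L = L_{G(O)}(r). -/
def pgLang (Γ : Set SAtom) (O : Ontology) (r : Role) (x y : ℕ) : Prop :=
  ∃ S ∈ lang O r, pgPath Γ S x y

/-- The edge relation of the directed graph determined by the role atoms of Γ. -/
def edgeRel (Γ : Set SAtom) (x y : ℕ) : Prop := ∃ r, SAtom.rel r x y ∈ Γ

/-- Γ forms a (directed) tree. -/
def FormsTree (Γ : Finset SAtom) : Prop :=
  Γ = ∅ ∨ ∃ root ∈ labSetF Γ,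
    (∀ x ∈ labSetF Γ, Relation.ReflTransGen (edgeRel ↑Γ) root x) ∧
    (∀ y, ¬ edgeRel ↑Γ y root) ∧
    (∀ x y y', edgeRel ↑Γ y x → edgeRel ↑Γ y' x → y = y')

/-- Γ ⊢ Δ is a sequent. -/
def IsSequent (Γ : Finset SAtom) (Δ : Multiset LC) : Prop :=
  FormsTree Γ ∧
  (Γ ≠ ∅ → ∀ p ∈ Δ, p.1 ∈ labSetF Γ) ∧
  (Γ = ∅ → ∃ x, Δlabels Δ = {x})

/-- y : O̅, the multiset of labeled concepts y : ¬̇C for the GCIs ⊤ ⊑ C of O. -/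
def obar (O : Ontology) (y : ℕ) : Multiset LC := O.gcis.val.map (fun C => (y, nnfNeg C))

/-- x : O̅ for every label x in a given finite set of labels. -/
def obarFor (O : Ontology) (ls : Finset ℕ) : Multiset LC := ls.val.bind (obar O)

/-- y is fresh, i.e. does not occur in the sequent Γ ⊢ Δ. -/
def FreshLabel (y : ℕ) (Γ : Finset SAtom) (Δ : Multiset LC) : Prop :=
  y ∉ labSetF Γ ∧ ∀ p ∈ Δ, p.1 ≠ y

/-- The set {yᵢ ≠̇ yⱼ | i < j}. -/
def neqSet {n : ℕ} (ys : Fin n → ℕ) : Finset SAtom :=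
  ((Finset.univ : Finset (Fin n × Fin n)).filter (fun p => p.1 < p.2)).image
    (fun p => SAtom.neq (ys p.1) (ys p.2))

/-- The set {r(x, yᵢ) | i}. -/
def relSet {n : ℕ} (r : Role) (x : ℕ) (ys : Fin n → ℕ) : Finset SAtom :=
  (Finset.univ : Finset (Fin n)).image (fun i => SAtom.rel r x (ys i))

/-- The multiset y₀ : ¬̇C, y₀ : O̅, …, yₙ : ¬̇C, yₙ : O̅. -/
def leΔ (O : Ontology) (C : Concept) {n : ℕ} (ys : Fin n → ℕ) : Multiset LC :=
  ∑ i : Fin n, ((ys i, nnfNeg C) ::ₘ obar O (ys i))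

/-- The sequent calculus S(O): `Deriv O Γ Δ n` states that the sequent Γ ⊢ Δ has
a proof in S(O) of height at most n. -/
inductive Deriv (O : Ontology) : Finset SAtom → Multiset LC → ℕ → Prop
  | id (Γ : Finset SAtom) (Δ : Multiset LC) (x A : ℕ) (n : ℕ) :
      Deriv O Γ ((x, Concept.atom A) ::ₘ (x, Concept.nneg A) ::ₘ Δ) n
  | idEq (Γ : Finset SAtom) (Δ : Multiset LC) (x y : ℕ) (n : ℕ)
      (hmem : SAtom.neq x y ∈ Γ) (h : eqRel ↑Γ x y) :
      Deriv O Γ Δ n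
  | subst (Γ : Finset SAtom) (Δ : Multiset LC) (x y : ℕ) (L : Concept) (n : ℕ)
      (hL : IsLiteral L) (h : eqRel ↑Γ x y)
      (p : Deriv O Γ ((x, L) ::ₘ (y, L) ::ₘ Δ) n) :
      Deriv O Γ ((x, L) ::ₘ Δ) (n + 1)
  | orR (Γ : Finset SAtom) (Δ : Multiset LC) (x : ℕ) (C D : Concept) (n : ℕ)
      (p : Deriv O Γ ((x, C) ::ₘ (x, D) ::ₘ Δ) n) :
      Deriv O Γ ((x, Concept.union C D) ::ₘ Δ) (n + 1)
  | andR (Γ : Finset SAtom) (Δ : Multiset LC) (x : ℕ) (C D : Concept) (n : ℕ)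
      (p : Deriv O Γ ((x, C) ::ₘ Δ) n) (q : Deriv O Γ ((x, D) ::ₘ Δ) n) :
      Deriv O Γ ((x, Concept.inter C D) ::ₘ Δ) (n + 1)
  | exR (Γ : Finset SAtom) (Δ : Multiset LC) (x y : ℕ) (r : Role) (C : Concept) (n : ℕ)
      (h : pgLang ↑Γ O r x y)
      (p : Deriv O Γ ((x, Concept.ex r C) ::ₘ (y, C) ::ₘ Δ) n) :
      Deriv O Γ ((x, Concept.ex r C) ::ₘ Δ) (n + 1)
  | allR (Γ : Finset SAtom) (Δ : Multiset LC) (x y : ℕ) (r : Role) (C : Concept) (n : ℕ)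
      (hy : FreshLabel y Γ ((x, Concept.all r C) ::ₘ Δ))
      (p : Deriv O (insert (SAtom.rel r x y) Γ) ((y, C) ::ₘ (obar O y + Δ)) n) :
      Deriv O Γ ((x, Concept.all r C) ::ₘ Δ) (n + 1)
  | leR (Γ : Finset SAtom) (Δ : Multiset LC) (x : ℕ) (r : Role) (C : Concept)
      (k : ℕ) (n : ℕ) (ys : Fin (k + 1) → ℕ)
      (hinj : Function.Injective ys)
      (hfresh : ∀ i, FreshLabel (ys i) Γ ((x, Concept.atMost k r C) ::ₘ Δ))
      (p : Deriv O (Γ ∪ neqSet ys ∪ relSet r x ys) (leΔ O C ys + Δ) n) :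
      Deriv O Γ ((x, Concept.atMost k r C) ::ₘ Δ) (n + 1)
  | geR (Γ : Finset SAtom) (Δ : Multiset LC) (x : ℕ) (r : Role) (C : Concept)
      (k : ℕ) (n : ℕ) (ys : Fin k → ℕ)
      (hpath : ∀ i, pgLang ↑Γ O r x (ys i))
      (p : ∀ i, Deriv O Γ ((ys i, C) ::ₘ (x, Concept.atLeast k r C) ::ₘ Δ) n)
      (q : ∀ i j : Fin k, i < j →
        Deriv O (insert (SAtom.eq (ys i) (ys j)) Γ) ((x, Concept.atLeast k r C) ::ₘ Δ) n) :
      Deriv O Γ ((x, Concept.atLeast k r C) ::ₘ Δ) (n + 1)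

/-- S(O) ⊩ Γ ⊢ Δ. -/
def SProvable (O : Ontology) (Γ : Finset SAtom) (Δ : Multiset LC) : Prop := ∃ n, Deriv O Γ Δ n

/-- Satisfaction of a structural atom under a label assignment. -/
def satAtom {δ : Type} (I : Interp δ) (lam : ℕ → δ) : SAtom → Prop
  | .rel r x y => (lam x, lam y) ∈ I.roleI r
  | .eq x y => lam x = lam y
  | .neq x y => lam x ≠ lam y

/-- I, λ ⊨^∀ Γ. -/
def satAll {δ : Type} (I : Interp δ) (lam : ℕ → δ) (Γ : Set SAtom) : Prop :=
  ∀ a ∈ Γ, satAtom I lam a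

/-- I, λ ⊨^∃ Δ. -/
def satEx {δ : Type} (I : Interp δ) (lam : ℕ → δ) (Δ : Multiset LC) : Prop :=
  ∃ p ∈ Δ, lam p.1 ∈ I.cInterp p.2

/-- ⊨_O Γ ⊢ Δ : validity of a sequent relative to O. -/
def ValidSeq (O : Ontology) (Γ : Finset SAtom) (Δ : Multiset LC) : Prop :=
  ∀ (δ : Type) [Nonempty δ] (I : Interp δ) (lam : ℕ → δ),
    I.models O → satAll I lam ↑Γ → satEx I lam Δ

/-- Label substitution (x/y) on labels: replace y by x. -/
def substLab (x y z : ℕ) : ℕ := if z = y then x else z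

/-- Label substitution (x/y) on structural atoms. -/
def SAtom.substL (x y : ℕ) : SAtom → SAtom
  | .rel r a b => .rel r (substLab x y a) (substLab x y b)
  | .eq a b => .eq (substLab x y a) (substLab x y b)
  | .neq a b => .neq (substLab x y a) (substLab x y b)

/-- Label substitution (x/y) on the antecedent. -/
def substΓ (x y : ℕ) (Γ : Finset SAtom) : Finset SAtom := Γ.image (SAtom.substL x y)

/-- Label substitution (x/y) on the consequent. -/
def substΔ (x y : ℕ) (Δ : Multiset LC) : Multiset LC := Δ.map (fun p => (substLab x y p.1, p.2))

/-- Exactly one of three propositions holds. -/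
def XOr3 (a b c : Prop) : Prop := (a ∧ ¬b ∧ ¬c) ∨ (¬a ∧ b ∧ ¬c) ∨ (¬a ∧ ¬b ∧ c)

/-- A member Γᵢ ⊢ Δᵢ of an interpolant. -/
abbrev ISeq := (Finset SAtom) × (Finset LC)

/-- 𝒢 is an interpolant: every member's antecedent consists of equality and
inequality atoms between distinct labels. -/
def IsInterpolant (G : Finset ISeq) : Prop :=
  ∀ p ∈ G, ∀ a ∈ p.1, ∃ x y : ℕ, x ≠ y ∧ (a = SAtom.eq x y ∨ a = SAtom.neq x y)

/-- The orthogonality condition between a member p of 𝒢 and a candidate q. -/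
def orthCond (p q : ISeq) : Prop :=
  XOr3 (∃ x y, SAtom.eq x y ∈ q.1 ∧ SAtom.neq x y ∈ p.1)
       (∃ x y, SAtom.neq x y ∈ q.1 ∧ SAtom.eq x y ∈ p.1)
       (∃ x C, (x, nnfNeg C) ∈ q.2 ∧ (x, C) ∈ p.2)

/-- The orthogonal 𝒢^⊥. -/
def OrthP (G : Set ISeq) : Set ISeq := {q | ∀ p ∈ G, orthCond p q}

/-- Labels occurring in a member of an interpolant. -/
def iseqLabels (p : ISeq) : Finset ℕ := labSetF p.1 ∪ p.2.image Prod.fst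

/-- Concept names occurring in a multiset of labeled concepts. -/
def ΔcnamesS (Δ : Multiset LC) : Set ℕ := {A | ∃ p ∈ Δ, A ∈ cnames p.2}

/-- Disjunction of a list of concepts. -/
def bigUnionL : List Concept → Concept
  | [] => botC
  | [C] => C
  | C :: D :: L => .union C (bigUnionL (D :: L))

/-- Conjunction of a list of concepts. -/
def bigInterL : List Concept → Concept
  | [] => topC
  | [C] => C
  | C :: D :: L => .inter C (bigInterL (D :: L))

/-- ⊓⊔𝒢 : the conjunction of the disjunctions of the members of 𝒢. -/
def interUnion (G : List (List Concept)) : Concept := bigInterL (G.map bigUnionL)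

/-- The interpolant {(⊢ x : C_{i,1}, …, x : C_{i,k_i}) | 1 ≤ i ≤ n}, as a set of ISeqs. -/
def simpleG (x : ℕ) (G : List (List Concept)) : Set ISeq :=
  {p | ∃ S ∈ G, p = (∅, (S.map (fun C => (x, C))).toFinset)}

/-- Renaming of concept names in a concept. -/
def renameC (ρ : ℕ → ℕ) : Concept → Concept
  | .atom A => .atom (ρ A)
  | .nneg A => .nneg (ρ A)
  | .inter C D => .inter (renameC ρ C) (renameC ρ D)
  | .union C D => .union (renameC ρ C) (renameC ρ D)
  | .ex r C => .ex r (renameC ρ C)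
  | .all r C => .all r (renameC ρ C)
  | .atMost n r C => .atMost n r (renameC ρ C)
  | .atLeast n r C => .atLeast n r (renameC ρ C)

/-- Renaming of concept names in an ontology. -/
def renameO (ρ : ℕ → ℕ) (O : Ontology) : Ontology := ⟨O.rias, O.gcis.image (renameC ρ)⟩

/-- C is implicitly concept-definable from Θ under O. -/
def ImplicitlyDefinable (C : Concept) (O : Ontology) (Θ : Finset ℕ) : Prop :=
  ∀ (δ : Type) [Nonempty δ] (I J : Interp δ), I.models O → J.models O →
    (∀ r, I.rI r = J.rI r) → (∀ A ∈ Θ, I.cI A = J.cI A) →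
    I.cInterp C = J.cInterp C

/-- C is explicitly concept-definable from Θ under O. -/
def ExplicitlyDefinable (C : Concept) (O : Ontology) (Θ : Finset ℕ) : Prop :=
  ∃ D : Concept, cnames D ⊆ Θ ∧ entails O C D ∧ entails O D C

/-- RIQ has the concept interpolation property. -/
def ConceptInterpolationProperty : Prop :=
  ∀ (O₁ O₂ : Ontology) (C D : Concept), entails (O₁.union O₂) C D →
    ∃ I : Concept, cnames I ⊆ (cnames C ∪ O₁.cnames) ∩ (cnames D ∪ O₂.cnames) ∧
      entails (O₁.union O₂) C I ∧ entails (O₁.union O₂) I D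

/-- RIQ has the concept-based Beth definability property. -/
def CBP : Prop :=
  ∀ (C : Concept) (O : Ontology) (Θ : Finset ℕ), Θ ⊆ cnames C ∪ O.cnames →
    ImplicitlyDefinable C O Θ → ExplicitlyDefinable C O Θ

theorem eqRel_mono {Γ Γ' : Set SAtom} (h : Γ ⊆ Γ') {x y : ℕ} (hxy : eqRel Γ x y) :
    eqRel Γ' x y :=
  Relation.ReflTransGen.mono (fun _ _ => Or.imp (@h _) (@h _)) _ _ hxy

theorem pgEdge_mono {Γ Γ' : Set SAtom} (h : Γ ⊆ Γ') {x y : ℕ} {r : Role}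
    (hxy : pgEdge Γ x r y) : pgEdge Γ' x r y :=
  hxy.imp
    (fun ⟨z, w, hz, hw, hr⟩ => ⟨z, w, eqRel_mono h hz, eqRel_mono h hw, h hr⟩)
    (fun ⟨z, w, hz, hw, hr⟩ => ⟨z, w, eqRel_mono h hz, eqRel_mono h hw, h hr⟩)

theorem pgPath_mono {Γ Γ' : Set SAtom} (h : Γ ⊆ Γ') {S : List Role} {x y : ℕ}
    (hxy : pgPath Γ S x y) : pgPath Γ' S x y := by
  induction S generalizing x with
  | nil => exact eqRel_mono h hxy
  | cons r S ih =>
    obtain ⟨z, hz, hp⟩ := hxy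
    exact ⟨z, pgEdge_mono h hz, ih hp⟩

theorem pgLang_mono {Γ Γ' : Set SAtom} (h : Γ ⊆ Γ') {O : Ontology} {r : Role} {x y : ℕ}
    (hxy : pgLang Γ O r x y) : pgLang Γ' O r x y := by
  obtain ⟨S, hS, hp⟩ := hxy
  exact ⟨S, hS, pgPath_mono h hp⟩

/-- The label a occurs in the sequent Γ ⊢ Δ. -/
def OccursIn (a : ℕ) (Γ : Finset SAtom) (Δ : Multiset LC) : Prop :=
  a ∈ labSetF Γ ∨ ∃ p ∈ Δ, p.1 = a

theorem mem_labels_iff_occursIn {a : ℕ} {Γ : Finset SAtom} {Δ : Multiset LC} :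
    a ∈ labSetF Γ ∪ Δlabels Δ ↔ OccursIn a Γ Δ := by
  simp [OccursIn, Δlabels]

theorem labSetF_mono {Γ Γ' : Finset SAtom} (h : Γ ⊆ Γ') : labSetF Γ ⊆ labSetF Γ' :=
  Finset.biUnion_subset_biUnion_of_subset_left _ h

theorem mem_labSetF_of_rel {Γ : Finset SAtom} {r : Role} {x y : ℕ} (h : SAtom.rel r x y ∈ Γ) :
    x ∈ labSetF Γ :=
  Finset.mem_biUnion.2 ⟨_, h, by simp [SAtom.labels]⟩

/-- A label occurring in Γ ⊢ x : C, Δ occurs in any larger sequent in which x occurs. -/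
theorem OccursIn.of_cons {a x : ℕ} {C : Concept} {Γ Γ' : Finset SAtom} {Δ Δ' : Multiset LC}
    (ha : OccursIn a Γ ((x, C) ::ₘ Δ)) (hΓ : Γ ⊆ Γ') (hΔ : Δ ⊆ Δ') (hx : OccursIn x Γ' Δ') :
    OccursIn a Γ' Δ' := by
  rcases ha with ha | ⟨p, hp, rfl⟩
  · exact .inl (labSetF_mono hΓ ha)
  · rcases Multiset.mem_cons.1 hp with rfl | hp
    · exact hx
    · exact .inr ⟨p, hΔ hp, rfl⟩

theorem FreshLabel.insert_neq {a b z : ℕ} {Γ : Finset SAtom} {Δ : Multiset LC}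
    (hz : FreshLabel z Γ Δ) (ha : OccursIn a Γ Δ) (hb : OccursIn b Γ Δ) :
    FreshLabel z (insert (SAtom.neq a b) Γ) Δ := by
  have ne_of_occursIn : ∀ {c}, OccursIn c Γ Δ → z ≠ c := by
    rintro c (hc | ⟨p, hp, hc⟩) rfl
    exacts [hz.1 hc, hz.2 p hp hc]
  refine ⟨?_, hz.2⟩
  rw [labSetF, Finset.biUnion_insert, Finset.mem_union, not_or]
  exact ⟨by simp [SAtom.labels, ne_of_occursIn ha, ne_of_occursIn hb], hz.1⟩

theorem Deriv.insert_neq {O : Ontology} {Γ : Finset SAtom} {Δ : Multiset LC} {a b h : ℕ}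
    (ha : OccursIn a Γ Δ) (hb : OccursIn b Γ Δ) (hd : Deriv O Γ Δ h) :
    Deriv O (insert (SAtom.neq a b) Γ) Δ h := by
  have sub (Γ : Finset SAtom) : (↑Γ : Set SAtom) ⊆ ↑(insert (SAtom.neq a b) Γ) :=
    Finset.coe_subset.2 (Finset.subset_insert _ _)
  induction hd with
  | id Γ Δ x A n => exact .id _ _ _ _ _
  | idEq Γ Δ x y n hmem h =>
    exact .idEq _ _ x y _ (Finset.mem_insert_of_mem hmem) (eqRel_mono (sub Γ) h)
  | subst Γ Δ x y L n hL h p ih =>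
    have occ {c} (hc : OccursIn c Γ ((x, L) ::ₘ Δ)) : OccursIn c Γ ((x, L) ::ₘ (y, L) ::ₘ Δ) :=
      hc.of_cons (Finset.Subset.refl _) (fun _ => by simp +contextual) (.inr ⟨(x, L), by simp⟩)
    exact .subst _ _ x y _ _ hL (eqRel_mono (sub Γ) h) (ih (occ ha) (occ hb))
  | orR Γ Δ x C D n p ih =>
    have occ {c} (hc : OccursIn c Γ ((x, .union C D) ::ₘ Δ)) :
        OccursIn c Γ ((x, C) ::ₘ (x, D) ::ₘ Δ) :=
      hc.of_cons (Finset.Subset.refl _) (fun _ => by simp +contextual) (.inr ⟨(x, C), by simp⟩)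
    exact .orR _ _ _ _ _ _ (ih (occ ha) (occ hb))
  | andR Γ Δ x C D n p q ihp ihq =>
    have occ {c E} (hc : OccursIn c Γ ((x, .inter C D) ::ₘ Δ)) : OccursIn c Γ ((x, E) ::ₘ Δ) :=
      hc.of_cons (Finset.Subset.refl _) (fun _ => by simp +contextual) (.inr ⟨(x, E), by simp⟩)
    exact .andR _ _ _ _ _ _ (ihp (occ ha) (occ hb)) (ihq (occ ha) (occ hb))
  | exR Γ Δ x y r C n h p ih =>
    have occ {c} (hc : OccursIn c Γ ((x, .ex r C) ::ₘ Δ)) :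
        OccursIn c Γ ((x, .ex r C) ::ₘ (y, C) ::ₘ Δ) :=
      hc.of_cons (Finset.Subset.refl _) (fun _ => by simp +contextual)
        (.inr ⟨(x, .ex r C), by simp⟩)
    exact .exR _ _ _ _ _ _ _ (pgLang_mono (sub Γ) h) (ih (occ ha) (occ hb))
  | allR Γ Δ x y r C n hy p ih =>
    have occ {c} (hc : OccursIn c Γ ((x, .all r C) ::ₘ Δ)) :
        OccursIn c (insert (.rel r x y) Γ) ((y, C) ::ₘ (obar O y + Δ)) :=
      hc.of_cons (Finset.subset_insert _ _) (fun _ => by simp +contextual)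
        (.inl (mem_labSetF_of_rel (Finset.mem_insert_self _ _)))
    refine .allR _ _ _ y _ _ _ (hy.insert_neq ha hb) ?_
    rw [Finset.insert_comm]
    exact ih (occ ha) (occ hb)
  | leR Γ Δ x r C k n ys hinj hfresh p ih =>
    have occ {c} (hc : OccursIn c Γ ((x, .atMost k r C) ::ₘ Δ)) :
        OccursIn c (Γ ∪ neqSet ys ∪ relSet r x ys) (leΔ O C ys + Δ) := by
      refine hc.of_cons ?_ (fun _ => by simp +contextual)
        (.inl (mem_labSetF_of_rel (r := r) (y := ys 0) ?_))
      · exact Finset.subset_union_left.trans Finset.subset_union_left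
      · simp [relSet]
    refine .leR _ _ _ _ _ _ _ ys hinj (fun i => (hfresh i).insert_neq ha hb) ?_
    rw [Finset.insert_union, Finset.insert_union]
    exact ih (occ ha) (occ hb)
  | geR Γ Δ x r C k n ys hpath p q ihp ihq =>
    have occ {c Γ' Δ'} (hΓ : Γ ⊆ Γ') (hΔ : (x, .atLeast k r C) ::ₘ Δ ⊆ Δ')
        (hc : OccursIn c Γ ((x, .atLeast k r C) ::ₘ Δ)) : OccursIn c Γ' Δ' :=
      hc.imp (@labSetF_mono _ _ hΓ _) (fun ⟨p, hp, e⟩ => ⟨p, hΔ hp, e⟩)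
    refine .geR _ _ _ _ _ _ _ ys (fun i => pgLang_mono (sub Γ) (hpath i)) (fun i => ?_)
      (fun i j hij => ?_)
    · have sub_cons := Multiset.subset_cons ((x, .atLeast k r C) ::ₘ Δ) (ys i, C)
      exact ihp i (occ (Finset.Subset.refl _) sub_cons ha) (occ (Finset.Subset.refl _) sub_cons hb)
    · rw [Finset.insert_comm]
      exact ihq i j hij (occ (Finset.subset_insert _ _) (Multiset.Subset.refl _) ha)
        (occ (Finset.subset_insert _ _) (Multiset.Subset.refl _) hb)

/-- Inequality weakening (w≠̇) is hp-admissible in S(O). -/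
theorem neq_weakening_hp_admissible (O : Ontology) (Γ : Finset SAtom) (Δ : Multiset LC)
    (x y : ℕ) (h : ℕ)
    (hx : x ∈ labSetF Γ ∪ Δlabels Δ) (hy : y ∈ labSetF Γ ∪ Δlabels Δ)
    (hd : Deriv O Γ Δ h) :
    Deriv O (insert (SAtom.neq x y) Γ) Δ h := by
  exact hd.insert_neq (mem_labels_iff_occursIn.1 hx) (mem_labels_iff_occursIn.1 hy)

end RIQ
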